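/- arXiv:2403.13702 — 2 statements merged into one kernel-verified Lean document; each statement's English description precedes it below -/
import Mathlib

section
/- Let 𝒢 = (G, γ, (≺_i)_{i∈[2]}) be a constrained level graph of height 2 without isolated vertices, with connected components C^1, …, C^k, and for each j let 𝒢^j be the constrained level graph obtained by restricting G, γ, and the orders to the vertices of C^j. Let H be the directed graph with one node per component and an arc from C^a to C^b (for a ≠ b) whenever there exist vertices u ∈ C^a, v ∈ C^b and i ∈ [2] with u ≺_i v. Then 𝒢 admits a constrained level planar drawing if and only if H is acyclic and each 𝒢^j admits a constrained level planar drawing. -/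
open scoped Classical

/-- A constrained level graph: a finite directed graph with a surjective level
assignment `lvl : V → {1, …, h}` such that edges go strictly upwards, together
with a partial order `≺ᵢ` on each level. -/
structure ConstrainedLevelGraph (V : Type) [Fintype V] where
  h : ℕ
  Edge : V → V → Prop
  lvl : V → ℕ
  lvl_one_le : ∀ v, 1 ≤ lvl v
  lvl_le : ∀ v, lvl v ≤ h
  lvl_surj : ∀ i, 1 ≤ i → i ≤ h → ∃ v, lvl v = i
  edge_lt : ∀ u v, Edge u v → lvl u < lvl v
  prec : ℕ → V → V → Prop
  prec_lvl : ∀ i u v, prec i u v → lvl u = i ∧ lvl v = i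
  prec_irrefl : ∀ i v, ¬ prec i v v
  prec_trans : ∀ i a b c, prec i a b → prec i b c → prec i a c

/-- A constrained level planar drawing of the subgraph of `G` induced by a
vertex set `W`: all conditions are imposed on vertices and edges inside `W`.
A drawing of the whole graph corresponds to `W = Set.univ`. -/
structure CLPDrawingOn {V : Type} [Fintype V] (G : ConstrainedLevelGraph V) (W : Set V) where
  x : V → ℝ
  f : V → V → ℝ → ℝ
  x_inj : ∀ u ∈ W, ∀ v ∈ W, G.lvl u = G.lvl v → x u = x v → u = v
  f_cont : ∀ u ∈ W, ∀ v ∈ W, G.Edge u v →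
    ContinuousOn (f u v) (Set.Icc (G.lvl u : ℝ) (G.lvl v : ℝ))
  f_src : ∀ u ∈ W, ∀ v ∈ W, G.Edge u v → f u v (G.lvl u : ℝ) = x u
  f_tgt : ∀ u ∈ W, ∀ v ∈ W, G.Edge u v → f u v (G.lvl v : ℝ) = x v
  planar : ∀ u ∈ W, ∀ v ∈ W, ∀ u' ∈ W, ∀ v' ∈ W, G.Edge u v → G.Edge u' v' →
    (u, v) ≠ (u', v') →
    ∀ t : ℝ, t ∈ Set.Icc (G.lvl u : ℝ) (G.lvl v : ℝ) →
      t ∈ Set.Icc (G.lvl u' : ℝ) (G.lvl v' : ℝ) → f u v t = f u' v' t →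
      ∃ w, (w = u ∨ w = v) ∧ (w = u' ∨ w = v') ∧ t = (G.lvl w : ℝ) ∧ f u v t = x w
  no_through : ∀ u ∈ W, ∀ v ∈ W, ∀ w ∈ W, G.Edge u v → w ≠ u → w ≠ v →
    G.lvl u ≤ G.lvl w → G.lvl w ≤ G.lvl v → f u v (G.lvl w : ℝ) ≠ x w
  prec_ok : ∀ i, ∀ u ∈ W, ∀ v ∈ W, G.prec i u v → x u < x v

variable {V : Type} [Fintype V]

/-- Undirected reachability (being in the same connected component). -/
def Reach (G : ConstrainedLevelGraph V) : V → V → Prop :=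
  Relation.ReflTransGen fun u v => G.Edge u v ∨ G.Edge v u

/-- An arc of the component–constraint graph `H`: the component of `a` and the
component of `b` are distinct and some constraint goes from the former to the
latter. -/
def CompArc (G : ConstrainedLevelGraph V) (a b : V) : Prop :=
  ¬ Reach G a b ∧ ∃ i u v, Reach G a u ∧ Reach G b v ∧ G.prec i u v

namespace ConstrainedLevelGraph

/-- Horizontal positions that are injective and order-respecting on each level of `W` and for
which the straight-line segments of the edges inside `W` do not cross. -/
structure IsPlacement (G : ConstrainedLevelGraph V) (W : Set V) (x : V → ℝ) : Prop where
  inj : ∀ u ∈ W, ∀ v ∈ W, G.lvl u = G.lvl v → x u = x v → u = v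
  prec_lt : ∀ i, ∀ u ∈ W, ∀ v ∈ W, G.prec i u v → x u < x v
  edge_mono : ∀ u ∈ W, ∀ v ∈ W, ∀ u' ∈ W, ∀ v' ∈ W, G.Edge u v → G.Edge u' v' →
    x u < x u' → x v ≤ x v'

variable {G : ConstrainedLevelGraph V}

theorem lvl_src (hh : G.h = 2) {u v : V} (e : G.Edge u v) : G.lvl u = 1 := by
  have := G.lvl_one_le u
  have := G.lvl_le v
  have := G.edge_lt u v e
  omega

theorem lvl_tgt (hh : G.h = 2) {u v : V} (e : G.Edge u v) : G.lvl v = 2 := by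
  have := G.lvl_one_le u
  have := G.lvl_le v
  have := G.edge_lt u v e
  omega

theorem isPlacement_of_drawing (hh : G.h = 2) {W : Set V} (D : CLPDrawingOn G W) :
    G.IsPlacement W D.x where
  inj := D.x_inj
  prec_lt := D.prec_ok
  edge_mono := by
    intro u hu v hv u' hu' v' hv' e e' hlt
    by_contra! hgt
    have hne : (u, v) ≠ (u', v') := by
      rintro h
      simp only [Prod.mk.injEq] at h
      exact hlt.ne (by rw [h.1])
    have c := D.f_cont u hu v hv e
    have c' := D.f_cont u' hu' v' hv' e'
    have s := D.f_src u hu v hv e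
    have s' := D.f_src u' hu' v' hv' e'
    have t := D.f_tgt u hu v hv e
    have t' := D.f_tgt u' hu' v' hv' e'
    have pl := D.planar u hu v hv u' hu' v' hv' e e' hne
    simp only [lvl_src hh e, lvl_src hh e', lvl_tgt hh e, lvl_tgt hh e', Nat.cast_one,
      Nat.cast_ofNat] at c c' s s' t t' pl
    obtain ⟨r, hr, h0⟩ : (0 : ℝ) ∈ (fun r => D.f u v r - D.f u' v' r) '' Set.Icc 1 2 := by
      refine intermediate_value_Icc (by norm_num) (c.sub c') ?_
      simp only [Set.mem_Icc, Pi.sub_apply, s, s', t, t']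
      constructor <;> linarith
    obtain ⟨w, hw, hw', -, -⟩ := pl r hr hr (sub_eq_zero.mp h0)
    have l1 := lvl_src hh e
    have l2 := lvl_tgt hh e
    have l1' := lvl_src hh e'
    have l2' := lvl_tgt hh e'
    rcases hw with rfl | rfl <;> rcases hw' with rfl | rfl
    · exact lt_irrefl _ hlt
    · omega
    · omega
    · exact lt_irrefl _ hgt

theorem segment_lt {a b c d t : ℝ} (hab : a < b) (hcd : c < d) (h1 : 1 ≤ t) (h2 : t ≤ 2) :
    (2 - t) * a + (t - 1) * c < (2 - t) * b + (t - 1) * d := by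
  have h := mul_le_mul_of_nonneg_left hab.le (sub_nonneg.mpr h2)
  rcases h1.eq_or_lt with rfl | h1
  · linarith
  · have h' := mul_lt_mul_of_pos_left hcd (sub_pos.mpr h1)
    linarith

theorem IsPlacement.nonempty_drawing (hh : G.h = 2) {W : Set V} {x : V → ℝ}
    (hx : G.IsPlacement W x) : Nonempty (CLPDrawingOn G W) := by
  refine ⟨⟨x, fun u v t => (2 - t) * x u + (t - 1) * x v, hx.inj, ?_, ?_, ?_, ?_, ?_,
    hx.prec_lt⟩⟩
  · intro u _ v _ _
    fun_prop
  · intro u _ v _ e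
    rw [lvl_src hh e]
    norm_num
  · intro u _ v _ e
    rw [lvl_tgt hh e]
    norm_num
  · intro u hu v hv u' hu' v' hv' e e' hne t ht _ heq
    have l1 := lvl_src hh e
    have l2 := lvl_tgt hh e
    have l1' := lvl_src hh e'
    have l2' := lvl_tgt hh e'
    simp only [l1, l2, Nat.cast_one, Nat.cast_ofNat] at ht
    obtain ⟨ht1, ht2⟩ := ht
    have key : (2 - t) * (x u - x u') + (t - 1) * (x v - x v') = 0 := by linarith
    by_cases huu : u = u'
    · subst huu
      have hvv : v ≠ v' := fun h => hne (by rw [h])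
      have hxv : x v - x v' ≠ 0 := fun h =>
        hvv (hx.inj v hv v' hv' (by omega) (sub_eq_zero.mp h))
      have ht : t = 1 := by
        have : (t - 1) * (x v - x v') = 0 := by linarith
        have := (mul_eq_zero.mp this).resolve_right hxv
        linarith
      refine ⟨u, Or.inl rfl, Or.inl rfl, ?_, ?_⟩
      · rw [l1, ht, Nat.cast_one]
      · rw [ht]; ring
    have hxu : x u ≠ x u' := fun h => huu (hx.inj u hu u' hu' (by omega) h)
    by_cases hvv : v = v'
    · subst hvv
      have ht : t = 2 := by
        have : (2 - t) * (x u - x u') = 0 := by linarith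
        have := (mul_eq_zero.mp this).resolve_right (sub_ne_zero.mpr hxu)
        linarith
      refine ⟨v, Or.inr rfl, Or.inr rfl, ?_, ?_⟩
      · rw [l2, ht, Nat.cast_ofNat]
      · rw [ht]; ring
    have hxv : x v ≠ x v' := fun h => hvv (hx.inj v hv v' hv' (by omega) h)
    exfalso
    rcases hxu.lt_or_gt with h | h
    · have h' := lt_of_le_of_ne (hx.edge_mono u hu v hv u' hu' v' hv' e e' h) hxv
      exact (segment_lt h h' ht1 ht2).ne heq
    · have h' := lt_of_le_of_ne (hx.edge_mono u' hu' v' hv' u hu v hv e' e h) hxv.symm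
      exact (segment_lt h h' ht1 ht2).ne' heq
  · intro u hu v hv w hw e hwu hwv h1 h2 heq
    have l1 := lvl_src hh e
    have l2 := lvl_tgt hh e
    obtain hl | hl : G.lvl w = 1 ∨ G.lvl w = 2 := by omega
    · rw [hl] at heq
      exact hwu (hx.inj w hw u hu (by omega) (by rw [← heq]; norm_num))
    · rw [hl] at heq
      exact hwv (hx.inj w hw v hv (by omega) (by rw [← heq]; norm_num))

theorem reach_refl (a : V) : Reach G a a := Relation.ReflTransGen.refl

theorem reach_trans {a b c : V} (h : Reach G a b) (h' : Reach G b c) : Reach G a c :=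
  Relation.ReflTransGen.trans h h'

theorem reach_symm {a b : V} (h : Reach G a b) : Reach G b a :=
  by
  induction h with
  | refl => exact reach_refl _
  | tail _ h ih => exact reach_trans (Relation.ReflTransGen.single h.symm) ih

theorem reach_of_edge {a b : V} (h : G.Edge a b) : Reach G a b :=
  Relation.ReflTransGen.single (Or.inl h)

theorem IsPlacement.src_lt_iff_tgt_lt (hh : G.h = 2) {x : V → ℝ}
    (hx : G.IsPlacement Set.univ x) {u v u' v' : V} (e : G.Edge u v) (e' : G.Edge u' v')
    (hn : ¬ Reach G u u') : x u < x u' ↔ x v < x v' := by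
  have l1 := lvl_src hh e
  have l2 := lvl_tgt hh e
  have l1' := lvl_src hh e'
  have l2' := lvl_tgt hh e'
  have hu : x u ≠ x u' := fun h => hn <| by
    rw [hx.inj u trivial u' trivial (by omega) h]
    exact reach_refl _
  have hv : x v ≠ x v' := fun h => hn <| by
    have := hx.inj v trivial v' trivial (by omega) h
    subst this
    exact reach_trans (reach_of_edge e) (reach_symm (reach_of_edge e'))
  constructor
  · intro h
    exact lt_of_le_of_ne
      (hx.edge_mono u trivial v trivial u' trivial v' trivial e e' h) hv
  · intro h
    by_contra! h'
    exact absurd (hx.edge_mono u' trivial v' trivial u trivial v trivial e' e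
      (lt_of_le_of_ne h' hu.symm)) (not_le.mpr h)

/-- In a placement of the whole graph, distinct components are ordered consistently. -/
theorem IsPlacement.component_lt (hh : G.h = 2) (hiso : ∀ v : V, ∃ u, G.Edge u v ∨ G.Edge v u)
    {x : V → ℝ} (hx : G.IsPlacement Set.univ x) {u v u' v' : V} (hn : ¬ Reach G u v)
    (hl : G.lvl u = G.lvl v) (hlt : x u < x v) (hu : Reach G u u') (hv : Reach G v v')
    (hl' : G.lvl u' = G.lvl v') : x u' < x v' := by
  have hinc : ∀ w : V, ∃ p q, G.Edge p q ∧ (w = p ∨ w = q) := by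
    intro w
    obtain ⟨z, e | e⟩ := hiso w
    exacts [⟨z, w, e, Or.inr rfl⟩, ⟨w, z, e, Or.inl rfl⟩]
  choose lo hi hedge hw using hinc
  have hreach : ∀ w, Reach G w (lo w) := by
    intro w
    rcases hw w with h | h
    · rw [← h]; exact reach_refl _
    · have := reach_symm (reach_of_edge (hedge w))
      rwa [← h] at this
  have hsep : ∀ {a b}, ¬ Reach G a b → ¬ Reach G (lo a) (lo b) := fun h h' =>
    h (reach_trans (hreach _) (reach_trans h' (reach_symm (hreach _))))
  have hsame : ∀ a b, ¬ Reach G a b → G.lvl a = G.lvl b →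
      (x (lo a) < x (lo b) ↔ x a < x b) := by
    intro a b hab hl
    have la := lvl_src hh (hedge a)
    have la' := lvl_tgt hh (hedge a)
    have lb := lvl_src hh (hedge b)
    have lb' := lvl_tgt hh (hedge b)
    rcases hw a with ha | ha <;> rcases hw b with hb | hb
    · rw [← ha, ← hb]
    · rw [← ha] at la; rw [← hb] at lb'; omega
    · rw [← ha] at la'; rw [← hb] at lb; omega
    · rw [hx.src_lt_iff_tgt_lt hh (hedge a) (hedge b) (hsep hab), ← ha, ← hb]
  have hlo : ∀ {p q}, G.Edge p q → lo p = p ∧ hi q = q := by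
    intro p q e
    have l1 := lvl_src hh e
    have l2 := lvl_tgt hh e
    have h1 := lvl_tgt hh (hedge p)
    have h2 := lvl_src hh (hedge q)
    constructor
    · rcases hw p with h | h
      · exact h.symm
      · rw [← h] at h1; omega
    · rcases hw q with h | h
      · rw [← h] at h2; omega
      · exact h.symm
  have hstep : ∀ p q b, G.Edge p q → ¬ Reach G p b →
      ((x (lo p) < x (lo b) ↔ x (lo q) < x (lo b)) ∧
        (x (lo b) < x (lo p) ↔ x (lo b) < x (lo q))) := by
    intro p q b e hp
    have hq : ¬ Reach G q b := fun h => hp (reach_trans (reach_of_edge e) h)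
    have hpb : ¬ Reach G p (lo b) := fun h => hp (reach_trans h (reach_symm (hreach b)))
    have h1 := hx.src_lt_iff_tgt_lt hh e (hedge b) hpb
    have h2 := hx.src_lt_iff_tgt_lt hh (hedge q) (hedge b) (hsep hq)
    have h3 := hx.src_lt_iff_tgt_lt hh (hedge b) e (fun h => hpb (reach_symm h))
    have h4 := hx.src_lt_iff_tgt_lt hh (hedge b) (hedge q) (fun h => hsep hq (reach_symm h))
    rw [(hlo e).2] at h2 h4
    rw [(hlo e).1]
    exact ⟨h1.trans h2.symm, h3.trans h4.symm⟩
  have hconst : ∀ a a' b, Reach G a a' → ¬ Reach G a b →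
      ((x (lo a) < x (lo b) ↔ x (lo a') < x (lo b)) ∧
        (x (lo b) < x (lo a) ↔ x (lo b) < x (lo a'))) := by
    intro a a' b h hab
    induction h with
    | refl => exact ⟨Iff.rfl, Iff.rfl⟩
    | @tail c d hc hcd ih =>
      have hcb : ¬ Reach G c b := fun h => hab (reach_trans hc h)
      have hdb : ¬ Reach G d b := fun h =>
        hcb (reach_trans (Relation.ReflTransGen.single hcd) h)
      rcases hcd with e | e
      · have := hstep c d b e hcb
        exact ⟨ih.1.trans this.1, ih.2.trans this.2⟩
      · have := hstep d c b e hdb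
        exact ⟨ih.1.trans this.1.symm, ih.2.trans this.2.symm⟩
  have hn' : ¬ Reach G u' v' := fun h =>
    hn (reach_trans hu (reach_trans h (reach_symm hv)))
  rw [← hsame u v hn hl] at hlt
  rw [← hsame u' v' hn' hl', ← (hconst v v' u' hv fun h => hn (reach_trans hu (reach_symm h))).2,
    ← (hconst u u' v hu hn).1]
  exact hlt

theorem exists_reach_lvl_eq (hh : G.h = 2) (hiso : ∀ v : V, ∃ u, G.Edge u v ∨ G.Edge v u)
    (a b : V) : ∃ c, Reach G b c ∧ G.lvl a = G.lvl c := by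
  have h1 := G.lvl_one_le a
  have h2 := G.lvl_le a
  obtain ⟨z, e | e⟩ := hiso b <;> have l1 := lvl_src hh e <;> have l2 := lvl_tgt hh e <;>
    by_cases hl : G.lvl a = G.lvl b
  · exact ⟨b, reach_refl b, hl⟩
  · exact ⟨z, reach_symm (reach_of_edge e), by omega⟩
  · exact ⟨b, reach_refl b, hl⟩
  · exact ⟨z, reach_of_edge e, by omega⟩

theorem IsPlacement.not_reach_of_transGen (hh : G.h = 2)
    (hiso : ∀ v : V, ∃ u, G.Edge u v ∨ G.Edge v u) {x : V → ℝ}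
    (hx : G.IsPlacement Set.univ x) {a b : V} (h : Relation.TransGen (CompArc G) a b) :
    ¬ Reach G a b := by
  have harc : ∀ {a b}, CompArc G a b →
      ∀ u v, Reach G a u → Reach G b v → G.lvl u = G.lvl v → x u < x v := by
    rintro a b ⟨hn, i, p, q, hp, hq, hpq⟩ u v hu hv hl
    have hlv := G.prec_lvl i p q hpq
    exact hx.component_lt hh hiso
      (fun h => hn (reach_trans hp (reach_trans h (reach_symm hq))))
      (hlv.1.trans hlv.2.symm) (hx.prec_lt i p trivial q trivial hpq)
      (reach_trans (reach_symm hp) hu) (reach_trans (reach_symm hq) hv) hl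
  have hall : ∀ u v, Reach G a u → Reach G b v → G.lvl u = G.lvl v → x u < x v := by
    induction h with
    | single h => exact harc h
    | @tail c d _ h ih =>
      intro u v hu hv hl
      obtain ⟨w, hw, hlw⟩ := exists_reach_lvl_eq hh hiso u c
      exact (ih u w hu hw hlw).trans (harc h w v hw hv (hlw.symm.trans hl))
  exact fun hr => lt_irrefl _ (hall b b hr (reach_refl b) rfl)

/-- The equivalence relation whose classes are the connected components. -/
def componentSetoid (G : ConstrainedLevelGraph V) : Setoid V :=
  ⟨Reach G, reach_refl, reach_symm, reach_trans⟩

theorem compArc_congr {a b a' b' : V} (ha : Reach G a a') (hb : Reach G b b')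
    (h : CompArc G a b) : CompArc G a' b' := by
  obtain ⟨hn, i, u, v, hu, hv, huv⟩ := h
  exact ⟨fun h => hn (reach_trans ha (reach_trans h (reach_symm hb))), i, u, v,
    reach_trans (reach_symm ha) hu, reach_trans (reach_symm hb) hv, huv⟩

/-- If the component–constraint graph is acyclic, it has a topological numbering. -/
theorem exists_component_rank
    (hac : ∀ a b : V, Relation.TransGen (CompArc G) a b → ¬ Reach G a b) :
    ∃ r : V → ℕ, (∀ u v, r u = r v ↔ Reach G u v) ∧ ∀ u v, CompArc G u v → r u < r v := by
  let := componentSetoid G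
  let Q := Quotient (componentSetoid G)
  let R : Q → Q → Prop := fun p q => CompArc G p.out q.out
  have hR : IsPartialOrder Q (Relation.ReflTransGen R) :=
    { refl := fun _ => Relation.ReflTransGen.refl
      trans := fun _ _ _ => Relation.ReflTransGen.trans
      antisymm := by
        intro p q hpq hqp
        rcases Relation.reflTransGen_iff_eq_or_transGen.mp hpq with h | h
        · exact h.symm
        · exact absurd (reach_refl _)
            (hac p.out p.out (Relation.TransGen.lift Quotient.out (fun _ _ h => h) _ _
              (h.trans_left hqp))) }
  obtain ⟨s, hs, hRs⟩ := extend_partialOrder (Relation.ReflTransGen R)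
  let r : Q → ℕ := fun q => (Finset.univ.filter fun p => s p q).card
  have hlt : ∀ p q, s p q → p ≠ q → r p < r q := by
    intro p q hpq hne
    apply Finset.card_lt_card
    rw [Finset.ssubset_iff_of_subset]
    · exact ⟨q, by simpa using hs.refl q, by
        simpa using fun h => hne (hs.antisymm p q hpq h)⟩
    · intro z hz
      simp only [Finset.mem_filter, Finset.mem_univ, true_and] at hz ⊢
      exact hs.trans z p q hz hpq
  have hout : ∀ v : V, Reach G v (Quotient.mk (componentSetoid G) v).out := fun v =>
    reach_symm (Quotient.mk_out v)
  refine ⟨fun v => r (Quotient.mk _ v), fun u v => ⟨fun h => ?_, fun h => ?_⟩, fun u v h => ?_⟩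
  · by_contra hn
    have hne : Quotient.mk (componentSetoid G) u ≠ Quotient.mk _ v :=
      fun h => hn (Quotient.exact h)
    rcases hs.total (Quotient.mk _ u) (Quotient.mk _ v) with h' | h'
    · exact (hlt _ _ h' hne).ne h
    · exact (hlt _ _ h' hne.symm).ne' h
  · exact congrArg r (Quotient.sound h)
  · exact hlt _ _ (hRs _ _ (Relation.ReflTransGen.single (compArc_congr (hout u) (hout v) h)))
      fun h' => h.1 (Quotient.exact h')

/-- Placements of the components combine to a placement of the whole graph by putting the
components, compressed to width `π`, next to each other in topological order. -/
theorem exists_isPlacement_univ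
    (hac : ∀ a b : V, Relation.TransGen (CompArc G) a b → ¬ Reach G a b)
    (hc : ∀ a : V, ∃ x, G.IsPlacement {v | Reach G a v} x) :
    ∃ x, G.IsPlacement Set.univ x := by
  obtain ⟨r, hr, hrlt⟩ := exists_component_rank hac
  choose X hX using hc
  let rep : V → V := fun v => (Quotient.mk (componentSetoid G) v).out
  have hrep : ∀ v, Reach G (rep v) v := fun v => by
    let := componentSetoid G
    exact Quotient.mk_out v
  have hrep_eq : ∀ {u v}, Reach G u v → rep u = rep v := fun h =>
    congrArg Quotient.out (Quotient.sound (s := componentSetoid G) h)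
  let x : V → ℝ := fun v => Real.pi * r v + Real.arctan (X (rep v) v)
  have hlt : ∀ u v, r u < r v → x u < x v := by
    intro u v h
    have h1 := Real.arctan_lt_pi_div_two (X (rep u) u)
    have h2 := Real.neg_pi_div_two_lt_arctan (X (rep v) v)
    have h3 : (r u : ℝ) + 1 ≤ r v := by exact_mod_cast h
    have h4 := mul_le_mul_of_nonneg_left h3 Real.pi_pos.le
    simp only [x]
    linarith
  have hle : ∀ u v, x u ≤ x v → r u ≤ r v := fun u v h => by
    by_contra! h'
    exact absurd (hlt v u h') (not_lt.mpr h)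
  have hsame : ∀ u v, Reach G u v → (x u < x v ↔ X (rep u) u < X (rep u) v) := by
    intro u v h
    simp only [x, (hr u v).mpr h, hrep_eq h, add_lt_add_iff_left, Real.arctan_strictMono.lt_iff_lt]
  have hmem : ∀ {u v}, Reach G u v → v ∈ {v | Reach G (rep u) v} :=
    fun h => reach_trans (hrep _) h
  refine ⟨x, ⟨?_, ?_, ?_⟩⟩
  · intro u _ v _ hl h
    have h' : Reach G u v := (hr u v).mp (le_antisymm (hle _ _ h.le) (hle _ _ h.ge))
    refine (hX (rep u)).inj u (hmem (reach_refl u)) v (hmem h') hl ?_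
    have h1 := (hsame u v h').not.mp h.not_lt
    have h2 := (hsame v u (reach_symm h')).not.mp h.symm.not_lt
    rw [← hrep_eq h'] at h2
    exact le_antisymm (not_lt.mp h2) (not_lt.mp h1)
  · intro i u _ v _ h
    by_cases h' : Reach G u v
    · exact (hsame u v h').mpr
        ((hX (rep u)).prec_lt i u (hmem (reach_refl u)) v (hmem h') h)
    · exact hlt u v (hrlt u v ⟨h', i, u, v, reach_refl u, reach_refl v, h⟩)
  · intro u _ v _ u' _ v' _ e e' h
    have hv := reach_of_edge e
    have hv' := reach_of_edge e'
    rcases (hle u u' h.le).lt_or_eq with h' | h'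
    · rw [(hr u v).mpr hv, (hr u' v').mpr hv'] at h'
      exact (hlt v v' h').le
    · have hu := (hr u u').mp h'
      have huv' := reach_trans hu hv'
      have := (hX (rep u)).edge_mono u (hmem (reach_refl u)) v (hmem hv) u' (hmem hu) v'
        (hmem huv') e e' ((hsame u u' hu).mp h)
      by_contra! h''
      have h3 := (hsame v' v (reach_trans (reach_symm huv') hv)).mp h''
      rw [← hrep_eq huv'] at h3
      exact absurd h3 (not_lt.mpr this)

theorem IsPlacement.mono {W W' : Set V} {x : V → ℝ} (hx : G.IsPlacement W x) (h : W' ⊆ W) :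
    G.IsPlacement W' x where
  inj u hu v hv := hx.inj u (h hu) v (h hv)
  prec_lt i u hu v hv := hx.prec_lt i u (h hu) v (h hv)
  edge_mono u hu v hv u' hu' v' hv' := hx.edge_mono u (h hu) v (h hv) u' (h hu') v' (h hv')

end ConstrainedLevelGraph

/-- A constrained level graph of height 2 without isolated
vertices admits a constrained level planar drawing iff its
component–constraint graph `H` is acyclic and each connected component
(with the restricted levels and orders) admits a constrained level planar
drawing. -/
theorem clp_two_levels_components (G : ConstrainedLevelGraph V) (hh : G.h = 2)
    (hiso : ∀ v : V, ∃ u, G.Edge u v ∨ G.Edge v u) :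
    Nonempty (CLPDrawingOn G Set.univ) ↔
      ((∀ a b : V, Relation.TransGen (CompArc G) a b → ¬ Reach G a b) ∧
        ∀ a : V, Nonempty (CLPDrawingOn G {v | Reach G a v})) := by
  constructor
  · rintro ⟨D⟩
    have hx := ConstrainedLevelGraph.isPlacement_of_drawing hh D
    exact ⟨fun a b h => hx.not_reach_of_transGen hh hiso h,
      fun a => (hx.mono (Set.subset_univ _)).nonempty_drawing hh⟩
  · rintro ⟨hac, hc⟩
    obtain ⟨x, hx⟩ := ConstrainedLevelGraph.exists_isPlacement_univ hac fun a =>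
      (hc a).elim fun D => ⟨D.x, ConstrainedLevelGraph.isPlacement_of_drawing hh D⟩
    exact hx.nonempty_drawing hh
end

section
/- A constrained level graph 𝒥 admits a constrained level planar drawing if and only if, for every strongly connected component 𝒞 of the component–constraint graph H_𝒥, the constrained level graph 𝒥_𝒞 obtained by restricting 𝒥 to the vertices of the components in 𝒞 admits a constrained level planar drawing. -/
open scoped Classical

variable {V : Type} [Fintype V]

/-- Reachability in the component–constraint graph `H` (as a relation on
representative vertices): same component, or a nonempty directed path. -/
def HReach (G : ConstrainedLevelGraph V) (a b : V) : Prop :=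
  Reach G a b ∨ Relation.TransGen (CompArc G) a b

/-- The vertices of the union of all components lying in the strongly connected
component of `H` that contains the component of `a`. -/
def SCCSet (G : ConstrainedLevelGraph V) (a : V) : Set V :=
  {v | HReach G a v ∧ HReach G v a}

variable {G : ConstrainedLevelGraph V}

theorem Reach.symm {a b : V} (h : Reach G a b) : Reach G b a :=
  have : Std.Symm fun u v => G.Edge u v ∨ G.Edge v u := ⟨fun _ _ => Or.symm⟩
  Relation.ReflTransGen.stdSymm.symm _ _ h

theorem Reach.trans {a b c : V} (h : Reach G a b) (h' : Reach G b c) : Reach G a c :=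
  Relation.ReflTransGen.trans h h'

theorem CompArc.congr_left {a a' b : V} (h : Reach G a' a) (hab : CompArc G a b) :
    CompArc G a' b := by
  obtain ⟨hn, i, u, v, hu, hv, hp⟩ := hab
  exact ⟨fun h' => hn (h.symm.trans h'), i, u, v, h.trans hu, hv, hp⟩

theorem CompArc.congr_right {a b b' : V} (hab : CompArc G a b) (h : Reach G b b') :
    CompArc G a b' := by
  obtain ⟨hn, i, u, v, hu, hv, hp⟩ := hab
  exact ⟨fun h' => hn (h'.trans h.symm), i, u, v, hu, h.symm.trans hv, hp⟩

theorem HReach.refl (a : V) : HReach G a a := Or.inl Relation.ReflTransGen.refl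

theorem HReach.trans {a b c : V} (hab : HReach G a b) (hbc : HReach G b c) : HReach G a c := by
  rcases hab with hab | hab
  · rcases hbc with hbc | hbc
    · exact Or.inl (hab.trans hbc)
    · obtain ⟨d, hbd, hdc⟩ := Relation.TransGen.head'_iff.1 hbc
      exact Or.inr (Relation.TransGen.head'_iff.2 ⟨d, hbd.congr_left hab, hdc⟩)
  · rcases hbc with hbc | hbc
    · obtain ⟨d, had, hdb⟩ := Relation.TransGen.tail'_iff.1 hab
      exact Or.inr (Relation.TransGen.tail'_iff.2 ⟨d, had, hdb.congr_right hbc⟩)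
    · exact Or.inr (hab.trans hbc)

theorem Reach.of_edge {u v : V} (h : G.Edge u v) : Reach G u v :=
  Relation.ReflTransGen.single (Or.inl h)

theorem HReach.of_prec {i : ℕ} {u v : V} (h : G.prec i u v) : HReach G u v := by
  by_cases hr : Reach G u v
  · exact Or.inl hr
  · exact Or.inr (.single
      ⟨hr, i, u, v, Relation.ReflTransGen.refl, Relation.ReflTransGen.refl, h⟩)

/-- A finite preorder has a monotone numbering separating its antisymmetry classes. -/
theorem exists_nat_rank_of_preorder (α : Type*) [Finite α] [Preorder α] :
    ∃ r : α → ℕ, Monotone r ∧ ∀ a b, r a = r b → a ≤ b := by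
  let L := LinearExtension (Antisymmetrization α (· ≤ ·))
  have : Finite L := Quotient.finite _
  have := Fintype.ofFinite L
  let e := (Fintype.orderIsoFinOfCardEq L rfl).symm
  refine ⟨fun a => e (toLinearExtension (toAntisymmetrization (· ≤ ·) a)), ?_, ?_⟩
  · intro a b h
    have h' : toAntisymmetrization (· ≤ ·) a ≤ toAntisymmetrization (· ≤ ·) b := h
    exact e.monotone (toLinearExtension.monotone h')
  · intro a b h
    have h' : toAntisymmetrization (· ≤ ·) a = toAntisymmetrization (· ≤ ·) b :=
      e.injective (Fin.ext h)
    exact (Quotient.exact h').1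

theorem exists_scc_rank (G : ConstrainedLevelGraph V) :
    ∃ r : V → ℕ, (∀ a b, HReach G a b → r a ≤ r b) ∧ ∀ a b, r a = r b → HReach G a b := by
  let _ : Preorder V :=
    { le := HReach G, le_refl := HReach.refl, le_trans := fun _ _ _ => HReach.trans }
  obtain ⟨r, hr, hr'⟩ := exists_nat_rank_of_preorder V
  exact ⟨r, fun _ _ h => hr h, hr'⟩

/-- A homeomorphic image of the real line inside the unit interval centred at `n`. -/
noncomputable def strip (n : ℕ) (t : ℝ) : ℝ := n + Real.arctan t / 4

theorem continuous_strip (n : ℕ) : Continuous (strip n) := by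
  unfold strip; fun_prop

theorem strip_strictMono (n : ℕ) : StrictMono (strip n) := fun s t h => by
  have := Real.arctan_strictMono h
  unfold strip; linarith

theorem strip_lt_strip {m n : ℕ} (h : m < n) (s t : ℝ) : strip m s < strip n t := by
  have h' : (m : ℝ) + 1 ≤ n := by exact_mod_cast h
  have := Real.arctan_lt_pi_div_two s
  have := Real.neg_pi_div_two_lt_arctan t
  have := Real.pi_lt_four
  unfold strip; linarith

theorem strip_eq_strip {m n : ℕ} {s t : ℝ} (h : strip m s = strip n t) : m = n ∧ s = t := by
  rcases lt_trichotomy m n with hmn | rfl | hmn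
  · exact absurd h (strip_lt_strip hmn s t).ne
  · exact ⟨rfl, (strip_strictMono m).injective h⟩
  · exact absurd h (strip_lt_strip hmn t s).ne'

namespace CLPDrawingOn

/-- Restriction of a drawing to a smaller vertex set. -/
def mono {W W' : Set V} (D : CLPDrawingOn G W) (h : W' ⊆ W) : CLPDrawingOn G W' where
  x := D.x
  f := D.f
  x_inj u hu v hv := D.x_inj u (h hu) v (h hv)
  f_cont u hu v hv := D.f_cont u (h hu) v (h hv)
  f_src u hu v hv := D.f_src u (h hu) v (h hv)
  f_tgt u hu v hv := D.f_tgt u (h hu) v (h hv)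
  planar u hu v hv u' hu' v' hv' := D.planar u (h hu) v (h hv) u' (h hu') v' (h hv')
  no_through u hu v hv w hw := D.no_through u (h hu) v (h hv) w (h hw)
  prec_ok i u hu v hv := D.prec_ok i u (h hu) v (h hv)

/-- The drawing with no vertices. -/
def empty (G : ConstrainedLevelGraph V) : CLPDrawingOn G ∅ where
  x := 0
  f := 0
  x_inj _ hu := hu.elim
  f_cont _ hu := hu.elim
  f_src _ hu := hu.elim
  f_tgt _ hu := hu.elim
  planar _ hu := hu.elim
  no_through _ hu := hu.elim
  prec_ok _ _ hu := hu.elim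

/-- Drawings of the fibres of a rank function that is constant along edges and monotone along
constraints can be placed side by side, in order of rank. -/
noncomputable def glue (r : V → ℕ) (hE : ∀ u v, G.Edge u v → r u = r v)
    (hP : ∀ i u v, G.prec i u v → r u ≤ r v) (D : ∀ n, CLPDrawingOn G {v | r v = n}) :
    CLPDrawingOn G Set.univ where
  x v := strip (r v) ((D (r v)).x v)
  f u v t := strip (r u) ((D (r u)).f u v t)
  x_inj u _ v _ hl h := by
    obtain ⟨hr, hx⟩ := strip_eq_strip h
    rw [← hr] at hx
    exact (D (r u)).x_inj u rfl v hr.symm hl hx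
  f_cont u _ v _ he :=
    (continuous_strip _).comp_continuousOn ((D (r u)).f_cont u rfl v (hE u v he).symm he)
  f_src u _ v _ he := by rw [(D (r u)).f_src u rfl v (hE u v he).symm he]
  f_tgt u _ v _ he := by rw [(D (r u)).f_tgt u rfl v (hE u v he).symm he, hE u v he]
  planar u _ v _ u' _ v' _ he he' hne t ht ht' h := by
    obtain ⟨hr, hf⟩ := strip_eq_strip h
    rw [← hr] at hf
    have hv := hE u v he
    obtain ⟨w, hw, hw', htw, hfw⟩ := (D (r u)).planar u rfl v hv.symm u' hr.symm v'
      ((hE u' v' he').symm.trans hr.symm) he he' hne t ht ht' hf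
    have hrw : r w = r u := by rcases hw with rfl | rfl <;> simp [hv]
    exact ⟨w, hw, hw', htw, by rw [hfw, hrw]⟩
  no_through u _ v _ w _ he hwu hwv hl hl' h := by
    obtain ⟨hr, hf⟩ := strip_eq_strip h
    rw [← hr] at hf
    exact (D (r u)).no_through u rfl v (hE u v he).symm w hr.symm he hwu hwv hl hl' hf
  prec_ok i u _ v _ h := by
    rcases (hP i u v h).lt_or_eq with hr | hr
    · exact strip_lt_strip hr _ _
    · rw [← hr]
      exact strip_strictMono _ ((D (r u)).prec_ok i u rfl v hr.symm h)

end CLPDrawingOn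

/-- A constrained level graph admits a constrained level planar
drawing iff for every strongly connected component `𝒞` of its
component–constraint graph `H`, the restriction to the vertices of the
components in `𝒞` admits a constrained level planar drawing. -/
theorem clp_iff_scc_drawable (G : ConstrainedLevelGraph V) :
    Nonempty (CLPDrawingOn G Set.univ) ↔
      ∀ a : V, Nonempty (CLPDrawingOn G (SCCSet G a)) := by
  refine ⟨fun ⟨D⟩ a => ⟨D.mono (Set.subset_univ _)⟩, fun h => ?_⟩
  obtain ⟨r, hr, hr'⟩ := exists_scc_rank G
  have hD (n : ℕ) : Nonempty (CLPDrawingOn G {v | r v = n}) := by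
    by_cases hn : ∃ a, r a = n
    · obtain ⟨a, rfl⟩ := hn
      obtain ⟨D⟩ := h a
      exact ⟨D.mono fun v hv => ⟨hr' a v (Eq.symm hv), hr' v a hv⟩⟩
    · exact ⟨(CLPDrawingOn.empty G).mono fun v hv => hn ⟨v, hv⟩⟩
  refine ⟨CLPDrawingOn.glue r (fun u v he => ?_) (fun i u v hp => hr u v (.of_prec hp))
    fun n => (hD n).some⟩
  exact le_antisymm (hr u v (Or.inl (.of_edge he))) (hr v u (Or.inl (Reach.of_edge he).symm))
end
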